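/- Let g be a nonconstant polynomial with rational coefficients and h a polynomial with rational coefficients. If α is a nonzero complex number with log(α) ≠ 0 satisfying g(log α) = h(α), then α is transcendental. -/

import Mathlib

section HermiteLindemann

open Polynomial

variable {K : Type*} [Field K]

theorem isIntegral_pow_mul_aeval {x : K} {D : ℤ} (hx : IsIntegral ℤ (D • x)) (P : ℤ[X]) {N : ℕ}
    (hN : P.natDegree ≤ N) : IsIntegral ℤ ((D : K) ^ N * aeval x P) := by
  rw [aeval_eq_sum_range' (Nat.lt_succ_of_le hN), Finset.mul_sum]
  refine IsIntegral.sum _ fun i hi => ?_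
  have hi : i ≤ N := by simpa [Nat.lt_succ_iff] using hi
  have h : (D : K) ^ N * P.coeff i • x ^ i = ((P.coeff i * D ^ (N - i) : ℤ) : K) * (D • x) ^ i := by
    rw [← Nat.sub_add_cancel hi]
    simp only [zsmul_eq_mul, Nat.add_sub_cancel]
    push_cast
    ring
  rw [h]
  exact (isIntegral_algebraMap (R := ℤ) (A := K) (x := P.coeff i * D ^ (N - i))).mul (hx.pow i)

/-- Evaluation of formal exponential sums along an embedding into `ℂ`. -/
noncomputable def expEval (φ : K →+* ℂ) : AddMonoidAlgebra ℤ K →ₐ[ℤ] ℂ :=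
  AddMonoidAlgebra.lift ℤ ℂ K
    { toFun := fun x => Complex.exp (φ x.toAdd)
      map_one' := by simp
      map_mul' := fun x y => by simp [Complex.exp_add] }

theorem expEval_apply (φ : K →+* ℂ) (f : AddMonoidAlgebra ℤ K) :
    expEval φ f = f.coeff.sum fun x c => (c : ℂ) * Complex.exp (φ x) := by
  simp [expEval, AddMonoidAlgebra.lift_apply]

variable [Algebra ℚ K]

theorem exists_int_eq_of_isIntegral_of_fixed [FiniteDimensional ℚ K] [IsGalois ℚ K] {x : K}
    (hx : IsIntegral ℤ x) (hfix : ∀ σ : Gal(K/ℚ), σ x = x) : ∃ z : ℤ, (z : K) = x := by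
  obtain ⟨q, rfl⟩ := IntermediateField.mem_bot.1 ((IsGalois.mem_bot_iff_fixed x).2 hfix)
  have hq : IsIntegral ℤ q :=
    (isIntegral_algebraMap_iff (FaithfulSMul.algebraMap_injective ℚ K)).1 hx
  obtain ⟨z, rfl⟩ := IsIntegrallyClosed.isIntegral_iff.1 hq
  exact ⟨z, by simp⟩

theorem map_finsuppSum_aeval_of_invariant (f : K →₀ ℤ) (hf : ∀ (σ : Gal(K/ℚ)) x, f (σ x) = f x)
    (P : ℤ[X]) (σ : Gal(K/ℚ)) :
    σ (f.sum fun x c => (c : K) * aeval x P) = f.sum fun x c => (c : K) * aeval x P := by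
  simp only [Finsupp.sum, map_sum, map_mul, map_intCast]
  refine Finset.sum_equiv σ.toEquiv (fun x => by simp [hf]) fun x _ => ?_
  have h : σ (aeval x P) = aeval (σ x) P :=
    (aeval_algHom_apply (σ.toAlgHom.restrictScalars ℤ) x P).symm
  simp [hf, h]

theorem exists_int_polynomial_of_finset [FiniteDimensional ℚ K] (s : Finset K) :
    ∃ g : ℤ[X], g.eval 0 ≠ 0 ∧ ∀ x ∈ s, x ≠ 0 → aeval x g = 0 := by
  have h (x : K) : ∃ q : ℤ[X], q.eval 0 ≠ 0 ∧ (x ≠ 0 → aeval x q = 0) := by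
    by_cases hx : x = 0
    · exact ⟨1, by simp, fun h => (h hx).elim⟩
    · have halg : IsAlgebraic ℤ x :=
        (IsFractionRing.isAlgebraic_iff ℤ ℚ K).2 (Algebra.IsAlgebraic.isAlgebraic x)
      obtain ⟨q, hq, hqx⟩ :=
        halg.exists_nonzero_coeff_and_aeval_eq_zero (mem_nonZeroDivisors_of_ne_zero hx)
      exact ⟨q, by rwa [← coeff_zero_eq_eval_zero], fun _ => hqx⟩
  choose q hq hqx using h
  refine ⟨∏ x ∈ s, q x, ?_, fun x hx hx0 => ?_⟩
  · rw [eval_prod]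
    exact Finset.prod_ne_zero_iff.2 fun x _ => hq x
  · rw [map_prod]
    exact Finset.prod_eq_zero hx (hqx x hx0)

open Filter Topology in
theorem tendsto_const_mul_mul_pow_div_factorial_pred (A B c : ℝ) :
    Tendsto (fun p : ℕ => A * (B ^ p * (c ^ p / (p - 1).factorial))) atTop (𝓝 0) := by
  rw [← tendsto_add_atTop_iff_nat 1]
  have h := (FloorSemiring.tendsto_pow_div_factorial_atTop (B * c)).const_mul (A * (B * c))
  rw [mul_zero] at h
  refine h.congr fun n => ?_
  simp only [Nat.add_sub_cancel, mul_pow, pow_succ]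
  ring

theorem int_add_sum_mul_exp_ne_zero [FiniteDimensional ℚ K] [IsGalois ℚ K] (φ : K →+* ℂ)
    (f : K →₀ ℤ) (hf : ∀ (σ : Gal(K/ℚ)) x, f (σ x) = f x)
    (h0 : f 0 = 0) {k : ℤ} (hk : k ≠ 0) :
    (k : ℂ) + f.sum (fun x c => (c : ℂ) * Complex.exp (φ x)) ≠ 0 := by
  intro hsum
  obtain ⟨g, hg0, hg⟩ := exists_int_polynomial_of_finset f.support
  obtain ⟨D, hD, hDint⟩ := exists_integral_multiples ℤ ℚ f.support
  obtain ⟨c, hc⟩ := LindemannWeierstrass.exp_polynomial_approx g hg0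
  set m := g.natDegree with hm
  set A : ℝ := ∑ x ∈ f.support, |(f x : ℝ)| with hA
  have hlim := tendsto_const_mul_mul_pow_div_factorial_pred A (|(D : ℝ)| ^ m) c
  obtain ⟨N, hN⟩ := Filter.eventually_atTop.1 (hlim.eventually_lt_const one_pos)
  obtain ⟨p, hp, hprime⟩ :=
    Nat.exists_infinite_primes (N + (eval 0 g).natAbs + D.natAbs + k.natAbs + 1)
  obtain ⟨n, hn, P, hP, hPr⟩ := hc p (by omega) hprime
  have hNp := hN p (by omega)
  have hPdeg : P.natDegree ≤ p * m := by omega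
  obtain ⟨z, hz⟩ := exists_int_eq_of_isIntegral_of_fixed
    (x := (D : K) ^ (p * m) * f.sum fun x c => (c : K) * aeval x P)
    (by
      rw [Finsupp.sum, Finset.mul_sum]
      refine IsIntegral.sum _ fun x hx => ?_
      rw [mul_left_comm]
      exact (isIntegral_algebraMap (R := ℤ) (A := K) (x := f x)).mul
        (isIntegral_pow_mul_aeval (hDint x hx) P hPdeg))
    (fun σ => by rw [map_mul, map_pow, map_intCast, map_finsuppSum_aeval_of_invariant f hf])
  have hφ (x : K) : φ (aeval x P) = aeval (φ x) P := (aeval_algHom_apply φ.toIntAlgHom x P).symm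
  have hzC : (z : ℂ) = (D : ℂ) ^ (p * m) * ∑ x ∈ f.support, (f x : ℂ) * aeval (φ x) P := by
    have := congrArg φ hz
    simpa [Finsupp.sum, hφ] using this
  have key : ((D ^ (p * m) * n * k + p * z : ℤ) : ℂ) = -(D : ℂ) ^ (p * m) *
      ∑ x ∈ f.support, (f x : ℂ) * (n • Complex.exp (φ x) - p • aeval (φ x) P) := by
    have hk' : (k : ℂ) = - ∑ x ∈ f.support, (f x : ℂ) * Complex.exp (φ x) :=
      eq_neg_of_add_eq_zero_left hsum
    push_cast
    rw [hzC, hk']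
    simp only [zsmul_eq_mul, nsmul_eq_mul, mul_sub, Finset.sum_sub_distrib,
      mul_left_comm _ (n : ℂ), mul_left_comm _ (p : ℂ), ← Finset.mul_sum]
    ring
  have hroot : ∀ x ∈ f.support, φ x ∈ g.aroots ℂ := fun x hx => by
    have hx0 : x ≠ 0 := by
      rintro rfl
      exact (Finsupp.mem_support_iff.1 hx) h0
    refine mem_aroots.2 ⟨fun h => hg0 (by simp [h]), ?_⟩
    have h := congrArg φ (hg x hx hx0)
    rw [map_zero] at h
    rw [← h]
    exact aeval_algHom_apply φ.toIntAlgHom x g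
  have hbound : ‖((D ^ (p * m) * n * k + p * z : ℤ) : ℂ)‖ < 1 := by
    rw [key]
    refine lt_of_le_of_lt ?_ hNp
    rw [norm_mul, norm_neg, norm_pow, Complex.norm_intCast, ← pow_mul, mul_comm m p,
      mul_left_comm, hA, Finset.sum_mul]
    gcongr
    refine norm_sum_le_of_le _ fun x hx => ?_
    rw [norm_mul, Complex.norm_intCast]
    gcongr
    exact hPr (hroot x hx)
  have hzero : D ^ (p * m) * n * k + p * z = 0 := by
    rw [Complex.norm_intCast] at hbound
    exact Int.abs_lt_one_iff.1 (by exact_mod_cast hbound)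
  have hdvd : (p : ℤ) ∣ D ^ (p * m) * n * k :=
    (Int.dvd_add_left (dvd_mul_right _ _)).1 (hzero ▸ dvd_zero _)
  have hp' := Nat.prime_iff_prime_int.1 hprime
  have hsmall {a : ℤ} (ha : a ≠ 0) (hap : a.natAbs < p) : ¬ (p : ℤ) ∣ a := fun h => by
    have := Nat.le_of_dvd (Int.natAbs_pos.2 ha) (Int.natCast_dvd.1 h)
    omega
  rcases hp'.dvd_or_dvd hdvd with h | h
  · rcases hp'.dvd_or_dvd h with h | h
    · exact hsmall hD (by omega) (hp'.dvd_of_dvd_pow h)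
    · exact hn h
  · exact hsmall hk (by omega) h

/-- The action of a Galois automorphism on formal exponential sums. -/
noncomputable def galAddMonoidAlgebra (σ : Gal(K/ℚ)) :
    AddMonoidAlgebra ℤ K →+* AddMonoidAlgebra ℤ K :=
  AddMonoidAlgebra.mapDomainRingHom ℤ (σ : K →+ K)

theorem galAddMonoidAlgebra_single (σ : Gal(K/ℚ)) (x : K) (c : ℤ) :
    galAddMonoidAlgebra σ (.single x c) = .single (σ x) c := by
  simp [galAddMonoidAlgebra]

theorem coeff_apply_of_galAddMonoidAlgebra_eq {f : AddMonoidAlgebra ℤ K} {σ : Gal(K/ℚ)}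
    (hf : galAddMonoidAlgebra σ f = f) (x : K) : f.coeff (σ x) = f.coeff x := by
  conv_lhs => rw [← hf]
  exact Finsupp.mapDomain_apply σ.injective f.coeff x

theorem expEval_ne_zero_of_invariant_of_coeff_zero [FiniteDimensional ℚ K] [IsGalois ℚ K]
    (φ : K →+* ℂ) {f : AddMonoidAlgebra ℤ K} (hf : ∀ σ : Gal(K/ℚ), galAddMonoidAlgebra σ f = f)
    (h0 : f.coeff 0 ≠ 0) : expEval φ f ≠ 0 := by
  have h := int_add_sum_mul_exp_ne_zero φ (f.coeff.erase 0) (fun σ x => ?_) (by simp) h0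
  · rw [expEval_apply, ← Finsupp.add_sum_erase' f.coeff 0 _ (by simp)]
    simpa using h
  · by_cases hx : x = 0
    · simp [hx]
    · rw [Finsupp.erase_ne hx, Finsupp.erase_ne (by simpa using hx),
        coeff_apply_of_galAddMonoidAlgebra_eq (hf σ)]

theorem expEval_ne_zero_of_invariant [FiniteDimensional ℚ K] [IsGalois ℚ K] (φ : K →+* ℂ)
    {f : AddMonoidAlgebra ℤ K} (hf : ∀ σ : Gal(K/ℚ), galAddMonoidAlgebra σ f = f)
    (h0 : f ≠ 0) : expEval φ f ≠ 0 := by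
  obtain ⟨y, hy⟩ : ∃ y, f.coeff y ≠ 0 := by
    by_contra! h
    exact h0 (AddMonoidAlgebra.ext (Finsupp.ext h))
  set u : AddMonoidAlgebra ℤ K := ∑ τ : Gal(K/ℚ), .single (-τ y) 1 with hu
  have huinv (σ : Gal(K/ℚ)) : galAddMonoidAlgebra σ u = u := by
    simp only [hu, map_sum, galAddMonoidAlgebra_single]
    exact Fintype.sum_equiv (Equiv.mulLeft σ) _ _ fun τ => by simp
  have hcoeff : (f * u).coeff 0 ≠ 0 := by
    have : (f * u).coeff 0 = ∑ _τ : Gal(K/ℚ), f.coeff y := by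
      simp only [hu, Finset.mul_sum, AddMonoidAlgebra.coeff_sum, Finsupp.finsetSum_apply]
      refine Finset.sum_congr rfl fun τ _ => ?_
      rw [AddMonoidAlgebra.coeff_mul_single_apply]
      simp [coeff_apply_of_galAddMonoidAlgebra_eq (hf τ)]
    rw [this]
    simpa using hy
  intro h
  refine expEval_ne_zero_of_invariant_of_coeff_zero φ (f := f * u)
    (fun σ => by rw [map_mul, hf, huinv]) hcoeff ?_
  rw [map_mul, h, zero_mul]

theorem aeval_single_ne_zero {x : K} (hx : x ≠ 0) {q : ℤ[X]} (hq : q ≠ 0) :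
    aeval (AddMonoidAlgebra.single x 1 : AddMonoidAlgebra ℤ K) q ≠ 0 := by
  have : CharZero K := algebraRat.charZero K
  intro h
  refine hq (Polynomial.ext fun i => ?_)
  have hi := congrArg (fun f : AddMonoidAlgebra ℤ K => f.coeff (i • x)) h
  rw [aeval_eq_sum_range' (n := q.natDegree + i + 1) (by omega)] at hi
  simp only [AddMonoidAlgebra.coeff_sum, Finsupp.finsetSum_apply,
    AddMonoidAlgebra.single_pow] at hi
  rw [Finset.sum_eq_single_of_mem i (by simp) (fun j _ hj => by simp [hj, hx])] at hi
  simpa using hi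

theorem transcendental_exp_of_ne_zero [FiniteDimensional ℚ K] [IsGalois ℚ K] (φ : K →+* ℂ)
    {x : K} (hx : x ≠ 0) :
    Transcendental ℤ (Complex.exp (φ x)) := by
  rintro ⟨q, hq, hqx⟩
  have hne : ∏ τ : Gal(K/ℚ),
      aeval (AddMonoidAlgebra.single (τ x) 1 : AddMonoidAlgebra ℤ K) q ≠ 0 :=
    Finset.prod_ne_zero_iff.2 fun τ _ => aeval_single_ne_zero (by simpa using hx) hq
  refine expEval_ne_zero_of_invariant φ (fun σ => ?_) hne ?_
  · rw [map_prod]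
    refine Fintype.prod_equiv (Equiv.mulLeft σ) _ _ fun τ => ?_
    rw [Equiv.coe_mulLeft, AlgEquiv.mul_apply, ← galAddMonoidAlgebra_single σ]
    exact (aeval_algHom_apply (galAddMonoidAlgebra σ).toIntAlgHom _ q).symm
  · rw [map_prod]
    refine Finset.prod_eq_zero (Finset.mem_univ 1) ?_
    rw [← aeval_algHom_apply, ← hqx]
    simp [expEval]

/-- The Hermite–Lindemann theorem. -/
theorem Complex.transcendental_exp {β : ℂ} (hβ : β ≠ 0) (halg : IsAlgebraic ℚ β) :
    Transcendental ℚ (Complex.exp β) := by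
  set p := minpoly ℚ β
  have hsep : p.Separable := (minpoly.irreducible halg.isIntegral).separable
  have hsplit : p.IsSplittingField ℚ (IntermediateField.adjoin ℚ (p.rootSet ℂ)) :=
    IntermediateField.adjoin_rootSet_isSplittingField (IsAlgClosed.splits _)
  have := IsGalois.of_separable_splitting_field
    (E := IntermediateField.adjoin ℚ (p.rootSet ℂ)) hsep
  have := IsSplittingField.finiteDimensional (IntermediateField.adjoin ℚ (p.rootSet ℂ)) p
  have hmem : β ∈ IntermediateField.adjoin ℚ (p.rootSet ℂ) :=
    IntermediateField.subset_adjoin ℚ _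
      (mem_rootSet.2 ⟨minpoly.ne_zero halg.isIntegral, minpoly.aeval ℚ β⟩)
  have h := transcendental_exp_of_ne_zero
    (algebraMap (IntermediateField.adjoin ℚ (p.rootSet ℂ)) ℂ) (x := ⟨β, hmem⟩)
    (fun h => hβ (congrArg Subtype.val h))
  exact fun h' => h ((IsFractionRing.isAlgebraic_iff ℤ ℚ ℂ).2 h')

end HermiteLindemann

/-- If `g` is a nonconstant rational polynomial, `h` a rational polynomial, and `α ≠ 0`
with `log α ≠ 0` satisfies `g (log α) = h α`, then `α` is transcendental. -/
theorem transcendental_of_poly_log (g h : Polynomial ℚ)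
    (hg : g.natDegree ≠ 0) (α : ℂ) (hα : α ≠ 0) (hlog : Complex.log α ≠ 0)
    (heq : Polynomial.aeval (Complex.log α) g = Polynomial.aeval α h) :
    Transcendental ℚ α := by
  intro halg
  have hh : IsAlgebraic ℚ (Polynomial.aeval α h) :=
    (Algebra.adjoin_le (S := integralClosure ℚ ℂ) (Set.singleton_subset_iff.2 halg.isIntegral)
      (Polynomial.aeval_mem_adjoin_singleton ℚ α)).isAlgebraic
  have hlogalg : IsAlgebraic ℚ (Complex.log α) :=
    IsAlgebraic.of_aeval g hg (by simpa using fun h0 => hg (by simp [h0])) (heq ▸ hh)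
  have hexp := Complex.transcendental_exp hlog hlogalg
  rw [Complex.exp_log hα] at hexp
  exact hexp halg
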